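/- Let 𝔤 be a Lie ring and K ≤ H almost ideals of 𝔤. Then the almost centraliser C̃_𝔤(H/K) = {x ∈ 𝔤 : ⁅x,H⁆ ⊆̃ K} is a Lie ideal of 𝔤. -/

import Mathlib

/-- `⁅x, ·⁆` as an additive monoid homomorphism of a Lie ring. -/
def adHom (L : Type*) [LieRing L] (x : L) : L →+ L :=
  AddMonoidHom.mk' (fun y => ⁅x, y⁆) (lie_add x)

/-- The additive subgroup `⁅x, H⁆ = {⁅x, h⁆ : h ∈ H}` of a Lie ring. -/
def brkt {L : Type*} [LieRing L] (x : L) (H : AddSubgroup L) : AddSubgroup L :=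
  H.map (adHom L x)

/-- `A` is almost contained in `B` (written `A ⊆̃ B`): `A ∩ B` has finite index in `A`. -/
def almostLE {G : Type*} [AddGroup G] (A B : AddSubgroup G) : Prop :=
  B.relIndex A ≠ 0

theorem adHom_apply {L : Type*} [LieRing L] (x y : L) : adHom L x y = ⁅x, y⁆ := rfl

theorem almostLE_brkt_iff {L : Type*} [LieRing L] {x : L} {H K : AddSubgroup L} :
    almostLE (brkt x H) K ↔ (K.comap (adHom L x)).relIndex H ≠ 0 := by
  rw [almostLE, brkt, AddSubgroup.relIndex_comap]

theorem almostLE.trans {G : Type*} [AddGroup G] {A B C : AddSubgroup G}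
    (hAB : almostLE A B) (hBC : almostLE B C) : almostLE A C :=
  AddSubgroup.relIndex_ne_zero_trans hBC hAB

theorem almostLE_brkt_zero {L : Type*} [LieRing L] (H K : AddSubgroup L) :
    almostLE (brkt 0 H) K := by
  have hle : H ≤ K.comap (adHom L 0) := fun h _ => by simp [adHom_apply]
  rw [almostLE_brkt_iff, AddSubgroup.relIndex_eq_one.2 hle]
  exact one_ne_zero

theorem almostLE_brkt_add {L : Type*} [LieRing L] {x y : L} {H K : AddSubgroup L}
    (hx : almostLE (brkt x H) K) (hy : almostLE (brkt y H) K) :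
    almostLE (brkt (x + y) H) K := by
  rw [almostLE_brkt_iff] at *
  refine mt (AddSubgroup.relIndex_eq_zero_of_le_left ?_) (AddSubgroup.relIndex_inf_ne_zero hx hy)
  rintro h ⟨h₁, h₂⟩
  simpa [adHom_apply] using K.add_mem h₁ h₂

theorem almostLE_brkt_zsmul {L : Type*} [LieRing L] (n : ℤ) {x : L} {H K : AddSubgroup L}
    (hx : almostLE (brkt x H) K) : almostLE (brkt (n • x) H) K := by
  rw [almostLE_brkt_iff] at *
  refine mt (AddSubgroup.relIndex_eq_zero_of_le_left fun h hh => ?_) hx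
  simpa [adHom_apply] using K.zsmul_mem hh n

theorem almostLE_brkt_lie {L : Type*} [LieRing L] {x y : L} {H K : AddSubgroup L}
    (hH : almostLE (brkt y H) H) (hK : almostLE (brkt y K) K) (hx : almostLE (brkt x H) K) :
    almostLE (brkt ⁅y, x⁆ H) K := by
  have hyx : almostLE (brkt x H) (K.comap (adHom L y)) :=
    hx.trans (almostLE_brkt_iff.1 hK)
  have hxy : almostLE (brkt y H) (K.comap (adHom L x)) :=
    hH.trans (almostLE_brkt_iff.1 hx)
  rw [almostLE_brkt_iff] at *
  refine mt (AddSubgroup.relIndex_eq_zero_of_le_left ?_)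
    (AddSubgroup.relIndex_inf_ne_zero hyx hxy)
  rintro h ⟨h₁, h₂⟩
  simpa [adHom_apply] using K.sub_mem h₁ h₂

/-- Let `𝔤` be a Lie ring and `K ≤ H` almost ideals of `𝔤` (additive subgroups with
`⁅x, H⁆ ⊆̃ H` for every `x ∈ 𝔤`).  Then the almost centraliser
`C̃_𝔤(H/K) = {x ∈ 𝔤 : ⁅x, H⁆ ⊆̃ K}` is a Lie ideal of `𝔤`. -/
theorem almostCentraliser_isLieIdeal
    (L : Type*) [LieRing L] (H K : AddSubgroup L) (hKH : K ≤ H)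
    (hH : ∀ x : L, almostLE (brkt x H) H) (hK : ∀ x : L, almostLE (brkt x K) K) :
    ∃ I : LieIdeal ℤ L, (I : Set L) = {x : L | almostLE (brkt x H) K} :=
  ⟨{ carrier := {x : L | almostLE (brkt x H) K}
     add_mem' := almostLE_brkt_add
     zero_mem' := almostLE_brkt_zero H K
     smul_mem' := fun n _ => almostLE_brkt_zsmul n
     lie_mem := fun {y _} => almostLE_brkt_lie (hH y) (hK y) }, rfl⟩
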